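/- arXiv:1504.03808 — 3 statements merged into one kernel-verified Lean document; each statement's English description precedes it below -/
import Mathlib

section
/- For every N ∈ ℕ: if a : {1,…,N} → ℝ is such that the trigonometric polynomial T(t) = 1 + ∑_{n=1}^N a(n)·cos(2πnt) satisfies T(t) ≥ 0 for all t ∈ ℝ, then a(1) ≤ 2·cos(π/(N+2)); moreover the bound is attained, i.e. M([1,N]) = 2·cos(π/(N+2)). -/
open Finset

/-- The Carathéodory–Fejér type trigonometric polynomial extremal quantity
`M(Ω)` for a set `Ω ⊆ {1,2,3,…}` of admissible frequencies. -/
noncomputable def Mconst (Ω : Set ℕ) : ℝ :=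
  sSup { v : ℝ | ∃ (N : ℕ) (a : ℕ → ℝ), 1 ≤ N ∧
    (∀ n ∈ Finset.Icc 1 N, n ∉ Ω → a n = 0) ∧
    (∀ t : ℝ, 0 ≤ 1 + ∑ n ∈ Finset.Icc 1 N, a n * Real.cos (2 * Real.pi * (n : ℝ) * t)) ∧
    v = a 1 }

/-- The cosines of an odd multiple grid: `∑ cos (n x)` over the `m`-th roots `e^{ix}` of `-1`
vanishes for `0 < n < m`. -/
theorem sum_cos_odd_mul_eq_zero {n m : ℕ} (hn : 0 < n) (hnm : n < m) :
    ∑ j ∈ range m, Real.cos (n * ((2 * j + 1) * (Real.pi / m))) = 0 := by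
  have hm : (0 : ℝ) < m := by exact_mod_cast hn.trans hnm
  set α : ℝ := n * (Real.pi / m) with hα
  have hpos : 0 < Real.sin α := by
    apply Real.sin_pos_of_pos_of_lt_pi
    · have : (0 : ℝ) < n := by exact_mod_cast hn
      have := Real.pi_pos
      positivity
    · have h : (n : ℝ) < m := by exact_mod_cast hnm
      rw [hα, mul_div_assoc', div_lt_iff₀ hm, mul_comm]
      exact mul_lt_mul_of_pos_left h Real.pi_pos
  have htel : ∀ k : ℕ, 2 * Real.sin α *
      ∑ j ∈ range k, Real.cos (n * ((2 * j + 1) * (Real.pi / m))) = Real.sin (2 * k * α) := by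
    intro k
    induction k with
    | zero => simp
    | succ k ih =>
      rw [sum_range_succ, mul_add, ih]
      have e1 : (n : ℝ) * ((2 * k + 1) * (Real.pi / m)) = 2 * k * α + α := by rw [hα]; ring
      have e2 : 2 * ((k + 1 : ℕ) : ℝ) * α = (2 * k * α + α) + α := by push_cast; ring
      have e3 : Real.sin (2 * k * α) = Real.sin ((2 * k * α + α) - α) := by ring_nf
      rw [e1, e2, e3, Real.sin_add (2 * k * α + α), Real.sin_sub]
      ring
  have h := htel m
  have e : 2 * (m : ℝ) * α = ((2 * n : ℕ) : ℝ) * Real.pi := by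
    rw [hα]; push_cast; field_simp
  rw [e, Real.sin_nat_mul_pi] at h
  exact (mul_eq_zero.mp h).resolve_left (by positivity)

theorem cos_odd_mul_le_cos {m j : ℕ} (hj : j < m) :
    Real.cos ((2 * j + 1) * (Real.pi / m)) ≤ Real.cos (Real.pi / m) := by
  have hm : (0 : ℝ) < m := by exact_mod_cast (Nat.zero_le j).trans_lt hj
  have hθ : 0 < Real.pi / m := div_pos Real.pi_pos hm
  have hmθ : (m : ℝ) * (Real.pi / m) = Real.pi := by field_simp
  have hjm : (j : ℝ) + 1 ≤ m := by exact_mod_cast hj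
  have hj0 : (0 : ℝ) ≤ j := j.cast_nonneg
  rcases le_total ((2 * (j : ℝ) + 1) * (Real.pi / m)) Real.pi with h | h
  · exact Real.cos_le_cos_of_nonneg_of_le_pi hθ.le h (by nlinarith)
  · rw [← Real.cos_two_pi_sub]
    exact Real.cos_le_cos_of_nonneg_of_le_pi hθ.le (by linarith) (by nlinarith)

/-- Upper bound, by integrating against the positive measure
`(cos (π / (N + 2)) - cos x)` on the `(N + 2)`-th roots of `-1`. -/
theorem coeff_one_le_of_nonneg {N : ℕ} (hN : 1 ≤ N) (a : ℕ → ℝ)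
    (ha : ∀ t : ℝ, 0 ≤ 1 + ∑ n ∈ Icc 1 N, a n * Real.cos (2 * Real.pi * (n : ℝ) * t)) :
    a 1 ≤ 2 * Real.cos (Real.pi / ((N : ℝ) + 2)) := by
  obtain ⟨m, hm⟩ : ∃ m : ℕ, m = N + 2 := ⟨_, rfl⟩
  have hmR : (N : ℝ) + 2 = m := by rw [hm]; push_cast; ring
  have hm0 : (0 : ℝ) < m := by rw [← hmR]; positivity
  rw [hmR]
  set θ : ℝ := Real.pi / m with hθ
  set x : ℕ → ℝ := fun j => (2 * j + 1) * θ with hx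
  have hT : ∀ y : ℝ, 0 ≤ 1 + ∑ n ∈ Icc 1 N, a n * Real.cos (n * y) := by
    intro y
    convert ha (y / (2 * Real.pi)) using 5
    field_simp
  have hS : ∀ n : ℕ, 0 < n → n < m → ∑ j ∈ range m, Real.cos (n * x j) = 0 :=
    fun n h1 h2 => sum_cos_odd_mul_eq_zero h1 h2
  have hS1 : ∑ j ∈ range m, Real.cos (x j) = 0 := by
    simpa using hS 1 one_pos (by omega)
  have hw : ∀ n ∈ Icc 1 N, ∑ j ∈ range m, (Real.cos θ - Real.cos (x j)) * Real.cos (n * x j)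
      = if n = 1 then -(m / 2 : ℝ) else 0 := by
    intro n hn
    rw [mem_Icc] at hn
    have hprod : ∀ j, (Real.cos θ - Real.cos (x j)) * Real.cos (n * x j) =
        Real.cos θ * Real.cos (n * x j) - (1 / 2) * Real.cos ((n + 1 : ℕ) * x j)
          - (1 / 2) * Real.cos ((n - 1 : ℕ) * x j) := by
      intro j
      rw [Nat.cast_sub hn.1]
      push_cast
      rw [add_mul, sub_mul, sub_mul, one_mul, Real.cos_add, Real.cos_sub]
      ring
    simp_rw [hprod]
    rw [sum_sub_distrib, sum_sub_distrib, ← mul_sum, ← mul_sum, ← mul_sum,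
      hS n (by omega) (by omega), hS (n + 1) (by omega) (by omega)]
    split_ifs with h
    · subst h; simp; ring
    · rw [hS (n - 1) (by omega) (by omega)]; simp
  have hnn : 0 ≤ ∑ j ∈ range m,
      (Real.cos θ - Real.cos (x j)) * (1 + ∑ n ∈ Icc 1 N, a n * Real.cos (n * x j)) :=
    sum_nonneg fun j hj => mul_nonneg
      (sub_nonneg.mpr (cos_odd_mul_le_cos (mem_range.mp hj))) (hT _)
  have heq : ∑ j ∈ range m,
      (Real.cos θ - Real.cos (x j)) * (1 + ∑ n ∈ Icc 1 N, a n * Real.cos (n * x j))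
      = m * Real.cos θ - a 1 * (m / 2) := by
    have hswap : ∑ j ∈ range m, (Real.cos θ - Real.cos (x j)) *
        ∑ n ∈ Icc 1 N, a n * Real.cos (n * x j) =
        ∑ n ∈ Icc 1 N, a n * ∑ j ∈ range m,
          (Real.cos θ - Real.cos (x j)) * Real.cos (n * x j) := by
      simp_rw [mul_sum]
      rw [sum_comm]
      exact sum_congr rfl fun _ _ => sum_congr rfl fun _ _ => by ring
    simp_rw [mul_add, mul_one]
    rw [sum_add_distrib, sum_sub_distrib, hS1, hswap,
      sum_congr (s₁ := Icc 1 N) rfl fun n hn => congrArg (a n * ·) (hw n hn)]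
    simp [hN]
    ring
  rw [heq] at hnn
  nlinarith

/-- Squared modulus of a trigonometric polynomial with real coefficients. -/
theorem sq_sum_cos_add_sq_sum_sin (c : ℕ → ℝ) (K : ℕ) (y : ℝ) :
    (∑ k ∈ range K, c k * Real.cos (k * y)) ^ 2 + (∑ k ∈ range K, c k * Real.sin (k * y)) ^ 2 =
      ∑ k ∈ range K, c k ^ 2 +
        ∑ l ∈ range K, ∑ k ∈ range l, 2 * (c k * c l) * Real.cos ((l - k : ℕ) * y) := by
  induction K with
  | zero => simp
  | succ K ih =>
    have h : ∑ k ∈ range K, 2 * (c k * c K) * Real.cos ((K - k : ℕ) * y) =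
        2 * (c K * Real.cos (K * y)) * (∑ k ∈ range K, c k * Real.cos (k * y)) +
        2 * (c K * Real.sin (K * y)) * (∑ k ∈ range K, c k * Real.sin (k * y)) := by
      rw [mul_sum, mul_sum, ← sum_add_distrib]
      refine sum_congr rfl fun k hk => ?_
      rw [Nat.cast_sub (mem_range.mp hk).le, sub_mul, Real.cos_sub]
      ring
    rw [sum_range_succ, sum_range_succ, sum_range_succ (fun k => c k ^ 2),
      sum_range_succ (fun l => ∑ k ∈ range l, 2 * (c k * c l) * Real.cos ((l - k : ℕ) * y)), h]
    linear_combination ih + c K ^ 2 * Real.sin_sq_add_cos_sq (K * y)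

theorem two_mul_sum_sin_mul_sin_succ (θ : ℝ) (n : ℕ) :
    ∑ l ∈ range n, 2 * (Real.sin ((l + 1) * θ) * Real.sin ((l + 2) * θ)) +
      Real.sin ((n + 1) * θ) * Real.sin ((n + 2) * θ) =
      2 * Real.cos θ * ∑ l ∈ range (n + 1), Real.sin ((l + 1) * θ) ^ 2 := by
  induction n with
  | zero => simp [Real.sin_two_mul]; ring
  | succ n ih =>
    rw [sum_range_succ, sum_range_succ _ (n + 1), mul_add, ← ih]
    push_cast
    have e0 : ((n : ℝ) + 1) * θ = (n + 2) * θ - θ := by ring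
    have e1 : ((n : ℝ) + 1 + 1) * θ = (n + 2) * θ := by ring
    have e2 : ((n : ℝ) + 1 + 2) * θ = (n + 2) * θ + θ := by ring
    rw [e0, e1, e2, Real.sin_add, Real.sin_sub]
    ring

/-- The extremal polynomial: the normalised squared modulus of
`∑ sin ((k + 1) π / (N + 2)) e^{ikx}`. -/
theorem exists_nonneg_coeff_one_eq (N : ℕ) : ∃ a : ℕ → ℝ,
    (∀ t : ℝ, 0 ≤ 1 + ∑ n ∈ Icc 1 N, a n * Real.cos (2 * Real.pi * (n : ℝ) * t)) ∧
    a 1 = 2 * Real.cos (Real.pi / ((N : ℝ) + 2)) := by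
  set θ : ℝ := Real.pi / ((N : ℝ) + 2) with hθ
  have hθpos : 0 < Real.sin θ := by
    apply Real.sin_pos_of_pos_of_lt_pi
    · have := Real.pi_pos
      positivity
    · apply div_lt_self Real.pi_pos
      have : (0 : ℝ) ≤ N := N.cast_nonneg
      linarith
  set c : ℕ → ℝ := fun k => Real.sin ((k + 1) * θ) with hc
  set S : ℝ := ∑ k ∈ range (N + 1), c k ^ 2 with hS
  have hSpos : 0 < S := by
    refine sum_pos' (fun _ _ => sq_nonneg _) ⟨0, by simp, ?_⟩
    simp only [hc, Nat.cast_zero, zero_add, one_mul]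
    positivity
  refine ⟨fun n => (∑ l ∈ range (N + 1), ∑ k ∈ range l,
    if l - k = n then 2 * (c k * c l) else 0) / S, fun t => ?_, ?_⟩
  · have hsum : ∑ n ∈ Icc 1 N, (∑ l ∈ range (N + 1), ∑ k ∈ range l,
        if l - k = n then 2 * (c k * c l) else 0) / S * Real.cos (2 * Real.pi * (n : ℝ) * t) =
        (∑ l ∈ range (N + 1), ∑ k ∈ range l,
          2 * (c k * c l) * Real.cos ((l - k : ℕ) * (2 * Real.pi * t))) / S := by
      simp_rw [div_mul_eq_mul_div]
      rw [← sum_div]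
      congr 1
      simp_rw [sum_mul]
      rw [sum_comm]
      refine sum_congr rfl fun l hl => ?_
      rw [sum_comm]
      refine sum_congr rfl fun k hk => ?_
      rw [mem_range] at hl hk
      simp_rw [ite_mul, zero_mul]
      rw [sum_ite_eq, if_pos (mem_Icc.mpr ⟨by omega, by omega⟩)]
      congr 2
      ring
    have h := sq_sum_cos_add_sq_sum_sin c (N + 1) (2 * Real.pi * t)
    rw [hsum, ← div_self hSpos.ne', ← add_div]
    exact div_nonneg (h ▸ add_nonneg (sq_nonneg _) (sq_nonneg _)) hSpos.le
  · have h := two_mul_sum_sin_mul_sin_succ θ N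
    have hpi : Real.sin (((N : ℝ) + 2) * θ) = 0 := by
      rw [hθ, mul_div_cancel₀ _ (by positivity), Real.sin_pi]
    rw [hpi, mul_zero, add_zero] at h
    have hinner : ∀ l : ℕ, (∑ k ∈ range (l + 1),
        if l + 1 - k = 1 then 2 * (c k * c (l + 1)) else 0) = 2 * (c l * c (l + 1)) := by
      intro l
      rw [sum_range_succ, sum_eq_zero, zero_add, if_pos (by omega)]
      intro k hk
      rw [mem_range] at hk
      rw [if_neg (by omega)]
    simp only
    rw [div_eq_iff hSpos.ne', sum_range_succ', range_zero, sum_empty, add_zero, ← h]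
    refine sum_congr rfl fun l _ => ?_
    rw [hinner]
    simp only [hc]
    push_cast
    ring_nf

theorem caratheodory_fejer (N : ℕ) (hN : 1 ≤ N) :
    (∀ a : ℕ → ℝ,
      (∀ t : ℝ, 0 ≤ 1 + ∑ n ∈ Finset.Icc 1 N, a n * Real.cos (2 * Real.pi * (n : ℝ) * t)) →
      a 1 ≤ 2 * Real.cos (Real.pi / ((N : ℝ) + 2))) ∧
    Mconst {n : ℕ | 1 ≤ n ∧ n ≤ N} = 2 * Real.cos (Real.pi / ((N : ℝ) + 2)) := by
  refine ⟨coeff_one_le_of_nonneg hN, IsGreatest.csSup_eq ⟨?_, ?_⟩⟩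
  · obtain ⟨a, ha, ha1⟩ := exists_nonneg_coeff_one_eq N
    exact ⟨N, a, hN, fun n hn hn' => absurd (mem_Icc.mp hn) hn', ha, ha1.symm⟩
  · rintro v ⟨N', a, hN', hΩ, ha, rfl⟩
    have h := coeff_one_le_of_nonneg hN (fun n => if n ≤ N' then a n else 0) fun t => by
      convert ha t using 2
      trans ∑ n ∈ Icc 1 (min N N'), a n * Real.cos (2 * Real.pi * (n : ℝ) * t)
      · symm
        refine sum_subset_zero_on_sdiff (Icc_subset_Icc_right (min_le_left _ _)) ?_ ?_
        · intro n hn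
          simp only [mem_sdiff, mem_Icc, le_min_iff] at hn
          rw [if_neg (by omega), zero_mul]
        · intro n hn
          simp only [mem_Icc, le_min_iff] at hn
          rw [if_pos hn.2.2]
      · refine sum_subset (Icc_subset_Icc_right (min_le_right _ _)) fun n hn hn' => ?_
        rw [hΩ n hn, zero_mul]
        simp only [mem_Icc, le_min_iff] at hn hn'
        simp only [Set.mem_ofPred_eq]
        omega
    simpa [hN'] using h
end

section
/- Let G be a group, H ≤ G a subgroup, and h : H → ℂ a positive definite function on H. Define g : G → ℂ by g(x) = h(x) for x ∈ H and g(x) = 0 for x ∉ H. Then g is positive definite on G. -/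
/-- A function `f : G → ℂ` on a group `G` is positive definite if for every `n`,
all `x₁,…,xₙ ∈ G` and `c₁,…,cₙ ∈ ℂ`, `∑_{j,k} c_j conj(c_k) f(x_j x_k⁻¹)` is a
nonnegative real number. -/
def IsPosDef {G : Type*} [Group G] (f : G → ℂ) : Prop :=
  ∀ (n : ℕ) (x : Fin n → G) (c : Fin n → ℂ),
    ∃ r : ℝ, 0 ≤ r ∧
      ∑ j : Fin n, ∑ k : Fin n, c j * (starRingEnd ℂ) (c k) * f (x j * (x k)⁻¹) = (r : ℂ)

theorem posdef_trivial_extension (G : Type*) [Group G] (H : Subgroup G) (h : H → ℂ)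
    (hpd : IsPosDef h) (g : G → ℂ)
    (hgH : ∀ (x : G) (hx : x ∈ H), g x = h ⟨x, hx⟩)
    (hgO : ∀ x : G, x ∉ H → g x = 0) :
    IsPosDef g := by
  classical
  intro n x c
  let q : Fin n → Quotient (QuotientGroup.rightRel H) := fun j => Quotient.mk _ (x j)
  have hq : ∀ j k, q j = q k ↔ x j * (x k)⁻¹ ∈ H := fun j k => by
    rw [eq_comm, Quotient.eq, QuotientGroup.rightRel_apply]
  have hrep : ∀ j, x j * (q j).out⁻¹ ∈ H := fun j =>
    QuotientGroup.rightRel_apply.mp (Quotient.mk_out (x j))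
  let y : Fin n → H := fun j => ⟨x j * (q j).out⁻¹, hrep j⟩
  have hgy : ∀ j k, g (x j * (x k)⁻¹) = if q j = q k then h (y j * (y k)⁻¹) else 0 := by
    intro j k
    split_ifs with hjk
    · rw [hgH _ ((hq j k).mp hjk)]
      congr 1
      ext
      simp [y, hjk]
    · exact hgO _ fun hmem => hjk ((hq j k).mpr hmem)
  choose r hr0 hr using fun a => hpd n y (fun j => if q j = a then c j else 0)
  refine ⟨∑ a ∈ Finset.univ.image q, r a, Finset.sum_nonneg fun a _ => hr0 a, ?_⟩
  push_cast
  simp_rw [← hr]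
  symm
  rw [Finset.sum_comm]
  refine Finset.sum_congr rfl fun j _ => ?_
  rw [Finset.sum_comm]
  refine Finset.sum_congr rfl fun k _ => ?_
  rw [hgy]
  refine (Finset.sum_eq_single_of_mem (q j)
    (Finset.mem_image_of_mem q (Finset.mem_univ j)) fun a _ ha => by simp [Ne.symm ha]).trans ?_
  by_cases hjk : q j = q k
  · simp [hjk]
  · simp [hjk, Ne.symm hjk]
end

section
/- Let ψ : ℤ → ℂ be a finitely supported positive definite sequence with supp ψ ⊆ [−N,N] for some N ∈ ℕ. Then there exists a sequence θ : ℤ → ℂ with supp θ ⊆ [0,N] such that θ⋆θ̃ = ψ, where (θ⋆θ̃)(n) := ∑_{k ∈ ℤ} θ(k)·conj(θ(k−n)). -/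
/-- A function `f : G → ℂ` on an additive group is positive definite if for every `n`,
all `x₁,…,xₙ ∈ G` and `c₁,…,cₙ ∈ ℂ`, `∑_{j,k} c_j conj(c_k) f(x_j - x_k)` is a
nonnegative real number. -/
def IsPosDefAdd {G : Type*} [AddGroup G] (f : G → ℂ) : Prop :=
  ∀ (n : ℕ) (x : Fin n → G) (c : Fin n → ℂ),
    ∃ r : ℝ, 0 ≤ r ∧
      ∑ j : Fin n, ∑ k : Fin n, c j * (starRingEnd ℂ) (c k) * f (x j - x k) = (r : ℂ)

section FejerRiesz

open Polynomial ComplexOrder ComplexConjugate Filter Topology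

/-- `conj z ^ N * P z` is a nonnegative real for every `z` on the unit circle. -/
def NonnegOnCircle (N : ℕ) (P : ℂ[X]) : Prop :=
  ∀ z : ℂ, ‖z‖ = 1 → 0 ≤ conj z ^ N * P.eval z

/-- The conjugate reversal `X ^ N * conj (P (1 / conj X))` of a polynomial of degree at most `N`. -/
noncomputable def conjReflect (N : ℕ) (P : ℂ[X]) : ℂ[X] :=
  (P.map (starRingEnd ℂ)).reflect N

lemma conj_mul_self_of_norm_eq_one {z : ℂ} (hz : ‖z‖ = 1) : conj z * z = 1 := by
  rw [Complex.conj_mul', hz]; simp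

lemma infinite_setOf_norm_eq_one : {z : ℂ | ‖z‖ = 1}.Infinite := by
  have h : IsPreconnected (Metric.sphere (0 : ℂ) 1) :=
    isPreconnected_sphere (by rw [Complex.rank_real_complex]; norm_num) 0 1
  have h2 := h.infinite_of_nontrivial ⟨1, by simp, -1, by simp, by norm_num⟩
  convert h2 using 1
  ext z; simp

lemma eval_conj_inv_conjReflect {N : ℕ} {P : ℂ[X]} (hP : P.natDegree ≤ N) {z : ℂ} (hz : z ≠ 0) :
    (conjReflect N P).eval (conj z)⁻¹ * conj z ^ N = conj (P.eval z) := by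
  have hz' : conj z ≠ 0 := by simpa using hz
  let _ := invertibleOfNonzero hz'
  have h := eval₂_reflect_mul_pow (RingHom.id ℂ) (conj z) N (P.map conj)
    (natDegree_map_le.trans hP)
  rw [eval₂_id, eval₂_id, eval_map, eval₂_at_apply] at h
  simpa [conjReflect] using h

lemma eval_conjReflect {N : ℕ} {P : ℂ[X]} (hP : P.natDegree ≤ N) {z : ℂ} (hz : ‖z‖ = 1) :
    (conjReflect N P).eval z = z ^ N * conj (P.eval z) := by
  have h1 := conj_mul_self_of_norm_eq_one hz
  have hz0 : z ≠ 0 := by rintro rfl; simp at hz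
  have h := eval_conj_inv_conjReflect hP hz0
  rw [inv_eq_of_mul_eq_one_right h1] at h
  rw [← h, mul_left_comm, ← mul_pow, mul_comm z, h1, one_pow, mul_one]

lemma conjReflect_mul {M N : ℕ} {P Q : ℂ[X]} (hP : P.natDegree ≤ M) (hQ : Q.natDegree ≤ N) :
    conjReflect (M + N) (P * Q) = conjReflect M P * conjReflect N Q := by
  rw [conjReflect, Polynomial.map_mul,
    reflect_mul _ _ (natDegree_map_le.trans hP) (natDegree_map_le.trans hQ)]
  rfl

lemma conjReflect_X_sub_C (w : ℂ) : conjReflect 1 (X - C w) = 1 - C (conj w) * X := by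
  have h : reflect 1 (X : ℂ[X]) = 1 := by simp
  simp [conjReflect, reflect_sub, reflect_C, h]

lemma coeff_conjReflect {N i : ℕ} (hi : i ≤ N) (P : ℂ[X]) :
    (conjReflect N P).coeff i = conj (P.coeff (N - i)) := by
  rw [conjReflect, coeff_reflect, revAt_le hi, coeff_map]

lemma hasDerivAt_exp_mul_I_mul (w : ℂ) :
    HasDerivAt (fun t : ℝ => Complex.exp (t * Complex.I) * w) (Complex.I * w) 0 := by
  have h1 : HasDerivAt (fun t : ℝ => (t : ℂ) * Complex.I) Complex.I 0 := by
    simpa using (Complex.ofRealCLM.hasDerivAt (x := (0 : ℝ))).mul_const Complex.I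
  simpa using h1.cexp.mul_const w

lemma norm_exp_mul_I_mul {w : ℂ} (hw : ‖w‖ = 1) (t : ℝ) :
    ‖Complex.exp (t * Complex.I) * w‖ = 1 := by
  rw [norm_mul, Complex.norm_exp_ofReal_mul_I, hw, one_mul]

namespace NonnegOnCircle

variable {N : ℕ} {P : ℂ[X]}

lemma conjReflect_eq (h : NonnegOnCircle N P) (hP : P.natDegree ≤ 2 * N) :
    conjReflect (2 * N) P = P := by
  refine eq_of_infinite_eval_eq _ _ (infinite_setOf_norm_eq_one.mono fun z hz => ?_)
  have h1 := conj_mul_self_of_norm_eq_one hz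
  have h2 := Complex.conj_eq_iff_im.2 (Complex.nonneg_iff.1 (h z hz)).2.symm
  have h3 : z ^ N * conj z ^ N = 1 := by rw [← mul_pow, mul_comm, h1, one_pow]
  change eval z _ = eval z _
  rw [eval_conjReflect hP hz]
  rw [map_mul, map_pow, Complex.conj_conj] at h2
  rw [two_mul, pow_add, mul_assoc, h2, ← mul_assoc, h3, one_mul]

lemma isRoot_conj_inv (h : NonnegOnCircle N P) (hP : P.natDegree ≤ 2 * N) {w : ℂ} (hw : w ≠ 0)
    (hr : P.IsRoot w) : P.IsRoot (conj w)⁻¹ := by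
  have h1 := eval_conj_inv_conjReflect hP hw
  rw [h.conjReflect_eq hP, hr.eq_zero, map_zero] at h1
  have : conj w ^ (2 * N) ≠ 0 := pow_ne_zero _ (by simpa using hw)
  exact (mul_eq_zero.1 h1).resolve_right this

lemma isRoot_derivative (h : NonnegOnCircle N P) {w : ℂ} (hw : ‖w‖ = 1) (hr : P.IsRoot w) :
    (derivative P).IsRoot w := by
  have hw0 : w ≠ 0 := by rintro rfl; simp at hw
  set γ : ℝ → ℂ := fun t => Complex.exp (t * Complex.I) * w with hγ
  have hγ0 : γ 0 = w := by simp [hγ]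
  have hd : HasDerivAt γ (Complex.I * w) 0 := hasDerivAt_exp_mul_I_mul w
  have hγP : HasDerivAt (fun t => P.eval (γ t)) (P.derivative.eval w * (Complex.I * w)) 0 := by
    have := (P.hasDerivAt (γ 0)).comp (0 : ℝ) hd
    rwa [hγ0] at this
  have hg : HasDerivAt (fun t => conj (γ t) ^ N * P.eval (γ t))
      (conj w ^ N * (P.derivative.eval w * (Complex.I * w))) 0 := by
    have hc : HasDerivAt (fun t => conj (γ t)) (conj (Complex.I * w)) 0 := hd.star
    have := (hc.pow N).mul hγP
    simp only [Pi.pow_apply, hγ0, hr.eq_zero, mul_zero, zero_add] at this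
    exact this
  have hnn : ∀ t, 0 ≤ conj (γ t) ^ N * P.eval (γ t) := fun t => h _ (norm_exp_mul_I_mul hw t)
  have hre := (Complex.reCLM.hasFDerivAt.comp_hasDerivAt (0 : ℝ) hg)
  have him := (Complex.imCLM.hasFDerivAt.comp_hasDerivAt (0 : ℝ) hg)
  have hre0 := IsLocalMin.hasDerivAt_eq_zero (Eventually.of_forall fun t => by
    simpa [hγ0, hr.eq_zero] using (Complex.nonneg_iff.1 (hnn t)).1) hre
  have him0 := IsLocalMin.hasDerivAt_eq_zero (Eventually.of_forall fun t => by
    simpa [hγ0, hr.eq_zero] using (Complex.nonneg_iff.1 (hnn t)).2.le) him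
  have hz : conj w ^ N * (P.derivative.eval w * (Complex.I * w)) = 0 :=
    Complex.ext hre0 him0
  simpa [hw0, Complex.I_ne_zero] using hz

lemma exists_eq_mul (h : NonnegOnCircle N P) (hP : P.natDegree ≤ 2 * N) {w : ℂ}
    (hr : P.IsRoot w) : ∃ R : ℂ[X], P = (X - C w) * (1 - C (conj w) * X) * R := by
  obtain ⟨S, rfl⟩ := dvd_iff_isRoot.2 hr
  by_cases hw : w = 0
  · exact ⟨S, by simp [hw]⟩
  have hw' : conj w ≠ 0 := by simpa using hw
  have hS : S.IsRoot (conj w)⁻¹ := by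
    by_cases hww : (conj w)⁻¹ = w
    · have hn : ‖w‖ = 1 := by
        have h1 : conj w * w = 1 := by
          conv_lhs => rw [← hww]
          rw [map_inv₀, Complex.conj_conj, hww, inv_mul_cancel₀ hw]
        rw [Complex.conj_mul'] at h1
        have h2 : ‖w‖ ^ 2 = 1 := by exact_mod_cast h1
        exact (pow_eq_one_iff_of_nonneg (norm_nonneg w) two_ne_zero).1 h2
      rw [hww]
      simpa [IsRoot, derivative_mul] using h.isRoot_derivative hn hr
    · have := h.isRoot_conj_inv hP hw hr
      simpa [IsRoot, sub_eq_zero, hww] using this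
  obtain ⟨R, rfl⟩ := dvd_iff_isRoot.2 hS
  refine ⟨C (-(conj w)⁻¹) * R, ?_⟩
  have hc : C (conj w) * C (conj w)⁻¹ = (1 : ℂ[X]) := by rw [← C_mul, mul_inv_cancel₀ hw', C_1]
  rw [C_neg]
  linear_combination (-(X - C w) * X * R) * hc

lemma of_mul {R : ℂ[X]} {w : ℂ}
    (h : NonnegOnCircle (N + 1) ((X - C w) * (1 - C (conj w) * X) * R)) : NonnegOnCircle N R := by
  have hne : ∀ z : ℂ, ‖z‖ = 1 → z ≠ w → 0 ≤ conj z ^ N * R.eval z := by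
    intro z hz hzw
    have h1 := conj_mul_self_of_norm_eq_one hz
    have h2 := h z hz
    have hpos : 0 < ‖z - w‖ ^ 2 := pow_pos (norm_pos_iff.2 (sub_ne_zero.2 hzw)) 2
    suffices h3 : 0 ≤ ((‖z - w‖ ^ 2 : ℝ) : ℂ) * (conj z ^ N * R.eval z) by
      have h4 := mul_nonneg (Complex.zero_le_real.2 (inv_nonneg.2 hpos.le)) h3
      rwa [← mul_assoc, ← Complex.ofReal_mul, inv_mul_cancel₀ hpos.ne', Complex.ofReal_one,
        one_mul] at h4
    convert h2 using 1
    rw [Complex.ofReal_pow, ← Complex.conj_mul']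
    simp only [map_sub, eval_mul, eval_sub, eval_X, eval_C, eval_one]
    linear_combination (conj z ^ N * R.eval z * (z - w) * conj w) * h1
  intro z hz
  have hz0 : z ≠ 0 := by rintro rfl; simp at hz
  have hd := hasDerivAt_exp_mul_I_mul z
  have hev := hd.eventually_ne (c := w) (mul_ne_zero Complex.I_ne_zero hz0)
  have hcont : Continuous fun t : ℝ => conj (Complex.exp (t * Complex.I) * z) ^ N *
      R.eval (Complex.exp (t * Complex.I) * z) := by
    have : Continuous fun t : ℝ => Complex.exp (t * Complex.I) * z := by fun_prop
    exact ((Complex.continuous_conj.comp this).pow N).mul (R.continuous.comp this)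
  have ht := (hcont.tendsto 0).mono_left (nhdsWithin_le_nhds (s := {0}ᶜ))
  have := ge_of_tendsto ht (hev.mono fun t ht => hne _ (norm_exp_mul_I_mul hz t) ht)
  simpa using this

lemma natDegree_le_of_mul {R : ℂ[X]} {w : ℂ}
    (h : NonnegOnCircle (N + 1) ((X - C w) * (1 - C (conj w) * X) * R))
    (hP : ((X - C w) * (1 - C (conj w) * X) * R).natDegree ≤ 2 * (N + 1)) :
    R.natDegree ≤ 2 * N := by
  by_cases hR : R = 0
  · simp [hR]
  by_cases hw : w = 0
  · subst hw
    have hs := congrArg (fun p => p.coeff 0) (h.conjReflect_eq hP)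
    simp only [coeff_conjReflect (Nat.zero_le _)] at hs
    simp only [map_zero, sub_zero, zero_mul, mul_one] at hs hP
    rw [mul_coeff_zero, coeff_X_zero, zero_mul, Nat.sub_zero] at hs
    have hs' : (X * R).coeff (2 * (N + 1)) = 0 := by simpa using hs
    have hXR : X * R ≠ 0 := mul_ne_zero X_ne_zero hR
    have hne : (X * R).natDegree ≠ 2 * (N + 1) := by
      intro he
      rw [← he, coeff_natDegree, leadingCoeff_eq_zero] at hs'
      exact hXR hs'
    rw [natDegree_mul X_ne_zero hR, natDegree_X] at hP hne
    omega
  · have hw' : -conj w ≠ 0 := by simpa using hw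
    have hl : (1 - C (conj w) * X : ℂ[X]) = C (-conj w) * X + C 1 := by
      rw [C_neg, C_1]; ring
    have hd : (1 - C (conj w) * X : ℂ[X]).natDegree = 1 := by
      rw [hl, natDegree_linear hw']
    have hl0 : (1 - C (conj w) * X : ℂ[X]) ≠ 0 := by
      intro h0; rw [h0] at hd; simp at hd
    rw [natDegree_mul (mul_ne_zero (X_sub_C_ne_zero w) hl0) hR,
      natDegree_mul (X_sub_C_ne_zero w) hl0, natDegree_X_sub_C, hd] at hP
    omega

lemma exists_isRoot (h : NonnegOnCircle (N + 1) P) (hP : P.natDegree ≤ 2 * (N + 1)) :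
    ∃ w, P.IsRoot w := by
  by_cases hd : P.degree = 0
  · have hs := congrArg (fun p => p.coeff 0) (h.conjReflect_eq hP)
    simp only [coeff_conjReflect (Nat.zero_le _)] at hs
    rw [coeff_eq_zero_of_natDegree_lt (by rw [natDegree_eq_of_degree_eq_some (n := 0) hd]; omega),
      map_zero] at hs
    exact ⟨0, by rw [IsRoot, ← coeff_zero_eq_eval_zero, hs]⟩
  · exact IsAlgClosed.exists_root P hd

/-- The Fejér–Riesz theorem for polynomials. -/
theorem exists_eq_mul_conjReflect (h : NonnegOnCircle N P) (hP : P.natDegree ≤ 2 * N) :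
    ∃ Q : ℂ[X], Q.natDegree ≤ N ∧ P = Q * conjReflect N Q := by
  induction N generalizing P with
  | zero =>
    obtain ⟨c, rfl⟩ : ∃ c, P = C c := ⟨_, eq_C_of_natDegree_le_zero hP⟩
    have hc : 0 ≤ c := by simpa using h 1 (by simp)
    obtain ⟨r, hr, rfl⟩ : ∃ r : ℝ, 0 ≤ r ∧ c = r := by
      obtain ⟨h1, h2⟩ := Complex.nonneg_iff.1 hc
      exact ⟨c.re, h1, Complex.ext (by simp) (by simp [← h2])⟩
    refine ⟨C (√r : ℂ), by simp, ?_⟩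
    simp only [conjReflect, map_C, reflect_C, pow_zero, mul_one, Complex.conj_ofReal]
    rw [← C_mul, ← Complex.ofReal_mul, Real.mul_self_sqrt hr]
  | succ N ih =>
    obtain ⟨w, hw⟩ := h.exists_isRoot hP
    obtain ⟨R, rfl⟩ := h.exists_eq_mul hP hw
    obtain ⟨Q, hQ, rfl⟩ := ih h.of_mul (h.natDegree_le_of_mul hP)
    have h1 : (X - C w).natDegree ≤ 1 := (natDegree_X_sub_C w).le
    refine ⟨(X - C w) * Q, natDegree_mul_le.trans (by omega), ?_⟩
    rw [add_comm N 1, conjReflect_mul h1 hQ, conjReflect_X_sub_C]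
    ring

end NonnegOnCircle

lemma sum_range_sum_range_sub_succ (a : ℤ → ℂ) (m : ℕ) :
    ∑ j ∈ Finset.range (m + 1), ∑ k ∈ Finset.range (m + 1), a (j - k) =
      ∑ j ∈ Finset.range m, ∑ k ∈ Finset.range m, a (j - k) +
        ∑ i ∈ Finset.range (2 * m + 1), a (i - m) := by
  have h : ∑ i ∈ Finset.range (2 * m + 1), a (i - m) =
      ∑ j ∈ Finset.range m, a (j - m) + ∑ k ∈ Finset.range (m + 1), a (m - k) := by
    rw [show 2 * m + 1 = m + (m + 1) by ring, Finset.sum_range_add]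
    congr 1
    rw [← Finset.sum_range_reflect]
    refine Finset.sum_congr rfl fun k hk => ?_
    rw [Finset.mem_range] at hk
    congr 1
    push_cast [show m + 1 - 1 - k = m - k by omega, Nat.cast_sub (show k ≤ m by omega)]
    ring
  rw [h, Finset.sum_range_succ]
  simp_rw [Finset.sum_range_succ _ m]
  rw [Finset.sum_add_distrib]
  ring

lemma sum_range_sub_eq_of_support_subset {a : ℤ → ℂ} {N m : ℕ} (hm : N ≤ m)
    (ha : Function.support a ⊆ Set.Icc (-(N : ℤ)) N) :
    ∑ i ∈ Finset.range (2 * m + 1), a (i - m) = ∑ᶠ n, a n := by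
  rw [finsum_eq_sum_of_support_subset a
    (s := (Finset.range (2 * m + 1)).image fun i : ℕ => (i : ℤ) - m), Finset.sum_image]
  · intro i _ j _ hij
    simpa using hij
  · intro n hn
    obtain ⟨h1, h2⟩ := ha hn
    simp only [Finset.coe_image, Finset.coe_range, Set.mem_image, Set.mem_Iio]
    exact ⟨(n + m).toNat, by omega, by omega⟩

lemma IsPosDefAdd.finsum_mul_zpow_nonneg {ψ : ℤ → ℂ} (hψ : IsPosDefAdd ψ) {N : ℕ}
    (hsupp : Function.support ψ ⊆ Set.Icc (-(N : ℤ)) N) {z : ℂ} (hz : ‖z‖ = 1) :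
    0 ≤ ∑ᶠ n : ℤ, z ^ n * ψ n := by
  have hz0 : z ≠ 0 := by rintro rfl; simp at hz
  have hconj : conj z = z⁻¹ := (inv_eq_of_mul_eq_one_left (conj_mul_self_of_norm_eq_one hz)).symm
  set a : ℤ → ℂ := fun n => z ^ n * ψ n with ha
  have hsa : Function.support a ⊆ Set.Icc (-(N : ℤ)) N := by
    intro n hn
    exact hsupp fun h0 => hn (by simp [ha, h0])
  set S : ℕ → ℂ := fun m => ∑ j ∈ Finset.range m, ∑ k ∈ Finset.range m, a (j - k) with hS
  have hSnn : ∀ m, 0 ≤ S m := by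
    intro m
    obtain ⟨r, hr, h⟩ := hψ m (fun j => (j : ℤ)) (fun j => z ^ (j : ℕ))
    have : S m = r := by
      rw [← h, hS]
      simp only [Finset.sum_range]
      refine Finset.sum_congr rfl fun j _ => Finset.sum_congr rfl fun k _ => ?_
      rw [ha, map_pow, hconj]
      simp only
      rw [zpow_sub₀ hz0, zpow_natCast, zpow_natCast, inv_pow, div_eq_mul_inv]
    rw [this]
    exact_mod_cast hr
  have hstep : ∀ m, S (N + m) = S N + m * ∑ᶠ n, a n := by
    intro m
    induction m with
    | zero => simp
    | succ m ih =>
      have := sum_range_sum_range_sub_succ a (N + m)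
      rw [sum_range_sub_eq_of_support_subset (by omega) hsa] at this
      change S (N + m + 1) = S (N + m) + _ at this
      rw [← add_assoc, this, ih]
      push_cast
      ring
  set F := ∑ᶠ n, a n
  rw [Complex.nonneg_iff]
  constructor
  · by_contra! hF
    obtain ⟨m, hm⟩ := exists_nat_gt ((S N).re / -F.re)
    rw [div_lt_iff₀ (by linarith)] at hm
    have := (Complex.nonneg_iff.1 (hSnn (N + m))).1
    rw [hstep] at this
    simp at this
    linarith
  · have h0 := (Complex.nonneg_iff.1 (hSnn N)).2
    have h1 := (Complex.nonneg_iff.1 (hSnn (N + 1))).2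
    rw [hstep] at h1
    simpa [← h0] using h1

lemma coeff_sum_range_monomial (f : ℕ → ℂ) (m i : ℕ) :
    (∑ k ∈ Finset.range m, monomial k (f k)).coeff i = if i < m then f i else 0 := by
  simp [coeff_monomial]

lemma IsPosDefAdd.nonnegOnCircle {ψ : ℤ → ℂ} (hψ : IsPosDefAdd ψ) {N : ℕ}
    (hsupp : Function.support ψ ⊆ Set.Icc (-(N : ℤ)) N) :
    NonnegOnCircle N (∑ k ∈ Finset.range (2 * N + 1), monomial k (ψ (k - N))) := by
  intro z hz
  have hz0 : z ≠ 0 := by rintro rfl; simp at hz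
  have hconj : conj z = z⁻¹ := (inv_eq_of_mul_eq_one_left (conj_mul_self_of_norm_eq_one hz)).symm
  have h := hψ.finsum_mul_zpow_nonneg hsupp hz
  rw [← sum_range_sub_eq_of_support_subset (a := fun n => z ^ n * ψ n) le_rfl
    fun n hn => hsupp fun h0 => hn (by simp [h0])] at h
  convert h using 1
  rw [eval_finsetSum, Finset.mul_sum]
  refine Finset.sum_congr rfl fun k _ => ?_
  rw [eval_monomial, hconj, zpow_sub₀ hz0, zpow_natCast, zpow_natCast, inv_pow, div_eq_mul_inv]
  ring

lemma coeff_mul_conjReflect {N : ℕ} {Q : ℂ[X]} (hQ : Q.natDegree ≤ N) {θ : ℤ → ℂ}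
    (hθ : ∀ k : ℕ, θ k = Q.coeff k) (hsupp : Function.support θ ⊆ Set.Icc (0 : ℤ) N)
    {n : ℤ} (hn : -(N : ℤ) ≤ n) :
    (Q * conjReflect N Q).coeff (n + N).toNat = ∑ᶠ k : ℤ, θ k * conj (θ (k - n)) := by
  have hzero : ∀ k : ℤ, ¬ (0 ≤ k ∧ k ≤ N) → θ k = 0 := fun k hk => by
    by_contra h
    exact hk (hsupp h)
  rw [coeff_mul, Finset.Nat.sum_antidiagonal_eq_sum_range_succ
    (fun i j => Q.coeff i * (conjReflect N Q).coeff j),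
    finsum_eq_sum_of_support_subset _
      (s := (Finset.range (n + N).toNat.succ).image fun i : ℕ => (i : ℤ)),
    Finset.sum_image (fun i _ j _ hij => by simpa using hij)]
  · refine Finset.sum_congr rfl fun k hk => ?_
    rw [Finset.mem_range] at hk
    rw [hθ]
    congr 1
    by_cases hkn : n ≤ k
    · rw [coeff_conjReflect (by omega), ← hθ]
      congr 2
      omega
    · rw [hzero _ (by omega), map_zero]
      have hlt : N < (n + N).toNat - k := by omega
      rw [conjReflect, coeff_reflect, revAt_eq_self_of_lt hlt, coeff_map,
        coeff_eq_zero_of_natDegree_lt (hQ.trans_lt hlt), map_zero]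
  · intro k hk
    have h1 := hsupp (a := k) fun h0 => hk (by simp [h0])
    have h2 := hsupp (a := k - n) fun h0 => hk (by simp [h0])
    simp only [Set.mem_Icc] at h1 h2
    simp only [Finset.coe_image, Finset.coe_range, Set.mem_image, Set.mem_Iio]
    exact ⟨k.toNat, by omega, by omega⟩

end FejerRiesz

theorem fejer_riesz (N : ℕ) (ψ : ℤ → ℂ) (hψ : IsPosDefAdd ψ)
    (hfin : (Function.support ψ).Finite)
    (hsupp : Function.support ψ ⊆ Set.Icc (-(N : ℤ)) (N : ℤ)) :
    ∃ θ : ℤ → ℂ, Function.support θ ⊆ Set.Icc (0 : ℤ) (N : ℤ) ∧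
      ∀ n : ℤ, ∑ᶠ k : ℤ, θ k * (starRingEnd ℂ) (θ (k - n)) = ψ n := by
  have hdeg : (∑ k ∈ Finset.range (2 * N + 1), Polynomial.monomial k (ψ (k - N))).natDegree
      ≤ 2 * N := by
    rw [Polynomial.natDegree_le_iff_coeff_eq_zero]
    intro i hi
    rw [coeff_sum_range_monomial (fun k => ψ (k - N)), if_neg (by omega)]
  obtain ⟨Q, hQ, hPQ⟩ := (hψ.nonnegOnCircle hsupp).exists_eq_mul_conjReflect hdeg
  set θ : ℤ → ℂ := fun k => if 0 ≤ k then Q.coeff k.toNat else 0 with hθ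
  have hθQ : ∀ k : ℕ, θ k = Q.coeff k := fun k => by simp [hθ]
  have hθs : Function.support θ ⊆ Set.Icc (0 : ℤ) N := by
    intro k hk
    by_contra hk'
    refine hk ?_
    by_cases h0 : 0 ≤ k
    · rw [Set.mem_Icc] at hk'
      simp only [hθ, if_pos h0]
      exact Polynomial.coeff_eq_zero_of_natDegree_lt (by omega)
    · simp only [hθ, if_neg h0]
  refine ⟨θ, hθs, fun n => ?_⟩
  by_cases hn : -(N : ℤ) ≤ n
  · rw [← coeff_mul_conjReflect hQ hθQ hθs hn, ← hPQ,
      coeff_sum_range_monomial (fun k => ψ (k - N))]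
    split_ifs with h
    · congr 1
      omega
    · by_contra h0
      have := (hsupp (Ne.symm h0)).2
      omega
  · have h1 : ψ n = 0 := by
      by_contra h0
      exact hn (hsupp h0).1
    rw [h1]
    refine finsum_eq_zero_of_forall_eq_zero fun k => ?_
    by_contra h0
    have h2 := hθs (a := k) fun h => h0 (by simp [h])
    have h3 := hθs (a := k - n) fun h => h0 (by simp [h])
    simp only [Set.mem_Icc] at h2 h3
    omega
end
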